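/- Let κ, β ∈ (0,1) and let ω : (0,1] → [0,∞) be bounded and measurable. Define ω̃(t) := ∑_{i=1}^∞ κ^{iβ}·( ω(κ^{−i}t) if κ^{−i}t ≤ 1, and ω(1) if κ^{−i}t > 1 ) for t ∈ (0,1]. Then: (i) if ∫₀¹ ω(t)/t dt < ∞, then ∫₀¹ ω̃(t)/t dt < ∞; and (ii) if in addition there exists C₁ ≥ 1 such that ω(s) ≤ C₁·ω(t) whenever 0 < s ≤ t ≤ 1, then ω(t) ≤ C₁·κ^{−β}·ω̃(t) for every t ∈ (0,1]. -/

import Mathlib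

open MeasureTheory Metric Set Filter

noncomputable section

/-- Euclidean space `ℝ^d`. -/
abbrev Euc (d : ℕ) := EuclideanSpace ℝ (Fin d)

/-- First-order partial derivative `D_i φ`. -/
noncomputable def pd {d : ℕ} (i : Fin d) (φ : Euc d → ℝ) (x : Euc d) : ℝ :=
  fderiv ℝ φ x (EuclideanSpace.single i 1)

/-- Second-order partial derivative `D_{ij} φ`. -/
noncomputable def pd2 {d : ℕ} (i j : Fin d) (φ : Euc d → ℝ) (x : Euc d) : ℝ :=
  pd i (pd j φ) x

/-- Mean oscillation function `ω_f(r)` of `f` on `U`. -/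
noncomputable def meanOsc {d : ℕ} {E : Type*} [NormedAddCommGroup E] [NormedSpace ℝ E]
    (f : Euc d → E) (U : Set (Euc d)) (r : ℝ) : ℝ :=
  ⨆ x : Euc d, ⨍ y in U ∩ ball x r, ‖f y - ⨍ z in U ∩ ball x r, f z‖

/-- `f` has Dini mean oscillation on `U`. -/
def DMO {d : ℕ} {E : Type*} [NormedAddCommGroup E] [NormedSpace ℝ E]
    (f : Euc d → E) (U : Set (Euc d)) : Prop :=
  IntegrableOn (fun t => meanOsc f U t / t) (Ioc (0:ℝ) 1)

/-- `sup_x ⨍_{U ∩ B_r(x)} ‖f‖`. -/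
noncomputable def supAvgNorm {d : ℕ} {E : Type*} [NormedAddCommGroup E]
    (f : Euc d → E) (U : Set (Euc d)) (r : ℝ) : ℝ :=
  ⨆ x : Euc d, ⨍ y in U ∩ ball x r, ‖f y‖

/-- Symmetry and uniform ellipticity of the coefficients `A` on `U`. -/
def UnifElliptic {d : ℕ} (lam Lam : ℝ) (A : Euc d → Fin d → Fin d → ℝ)
    (U : Set (Euc d)) : Prop :=
  ∀ x ∈ U, (∀ i j, A x i j = A x j i) ∧
    ∀ ξ : Euc d,
      lam * ‖ξ‖ ^ 2 ≤ ∑ i, ∑ j, A x i j * ξ i * ξ j ∧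
        ∑ i, ∑ j, A x i j * ξ i * ξ j ≤ Lam * ‖ξ‖ ^ 2

/-- `φ ∈ C_c^∞(U)`. -/
def IsTestFun {d : ℕ} (U : Set (Euc d)) (φ : Euc d → ℝ) : Prop :=
  ContDiff ℝ (⊤ : ℕ∞) φ ∧ HasCompactSupport φ ∧ tsupport φ ⊆ U

/-- A modulus of continuity. -/
def IsModulus (ϱ : ℝ → ℝ) : Prop :=
  (∀ r, 0 ≤ ϱ r) ∧ MonotoneOn ϱ (Ioi (0:ℝ)) ∧
    Tendsto ϱ (nhdsWithin 0 (Ioi 0)) (nhds 0)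

/-- `ω_coef(r) = ω_A(r) + r·sup⨍|b| + r²·sup⨍|c|`. -/
noncomputable def omegaCoef {d : ℕ} (A : Euc d → Fin d → Fin d → ℝ) (b : Euc d → Euc d)
    (c : Euc d → ℝ) (U : Set (Euc d)) (r : ℝ) : ℝ :=
  meanOsc A U r + r * supAvgNorm b U r + r ^ 2 * supAvgNorm c U r

/-- `ω_dat(r) = ω_{Df}(r) + ω_g(r) + r·sup⨍|h|`. -/
noncomputable def omegaDat {d : ℕ} (f : Euc d → Fin d → Fin d → ℝ) (g : Euc d → Euc d)
    (h : Euc d → ℝ) (U : Set (Euc d)) (r : ℝ) : ℝ :=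
  meanOsc (fun x => fderiv ℝ f x) U r + meanOsc g U r + r * supAvgNorm h U r

/-- Weak (adjoint) solution of `L*u = div²f + div g + h` in `U`. -/
def IsAdjSol {d : ℕ} (A : Euc d → Fin d → Fin d → ℝ) (b : Euc d → Euc d) (c : Euc d → ℝ)
    (f : Euc d → Fin d → Fin d → ℝ) (g : Euc d → Euc d) (h : Euc d → ℝ)
    (U : Set (Euc d)) (u : Euc d → ℝ) : Prop :=
  ∀ φ : Euc d → ℝ, IsTestFun U φ →
    ∫ x in U, u x * ((∑ i, ∑ j, A x i j * pd2 i j φ x) +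
        (∑ i, b x i * pd i φ x) + c x * φ x)
      = ∫ x in U, ((∑ i, ∑ j, f x i j * pd2 i j φ x) -
          (∑ i, g x i * pd i φ x) + h x * φ x)

/-- Weak solution of `div²(Au) = 0` in `U`. -/
def IsDDSol {d : ℕ} (A : Euc d → Fin d → Fin d → ℝ) (U : Set (Euc d)) (u : Euc d → ℝ) : Prop :=
  ∀ φ : Euc d → ℝ, IsTestFun U φ →
    (∫ x in U, u x * (∑ i, ∑ j, A x i j * pd2 i j φ x)) = 0

/-- `u ∈ W^{1,p}₀(U)` with weak gradient `Du`: `Du` is the weak gradient of `u` on `U`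
and `u` is approximated in the `W^{1,p}` norm by functions in `C_c^∞(U)`. -/
def MemW1p0 {d : ℕ} (p : ℝ) (U : Set (Euc d)) (u : Euc d → ℝ) (Du : Euc d → Euc d) : Prop :=
  (∀ (i : Fin d) (φ : Euc d → ℝ), IsTestFun U φ →
      ∫ x in U, u x * pd i φ x = - ∫ x in U, Du x i * φ x) ∧
  ∃ φ : ℕ → Euc d → ℝ, (∀ n, IsTestFun U (φ n)) ∧
    Tendsto (fun n => ∫ x in U, (|u x - φ n x| ^ p +
      (∑ i, |Du x i - pd i (φ n) x| ^ 2) ^ (p / 2))) atTop (nhds 0)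

/-- The index of the last coordinate `x_d`. -/
def lastCoord (d : ℕ) [NeZero d] : Fin d :=
  ⟨d - 1, Nat.sub_lt (Nat.pos_of_ne_zero (NeZero.ne d)) one_pos⟩

/-- The open upper half space `{x_d > 0}`. -/
def upperHalf (d : ℕ) [NeZero d] : Set (Euc d) := {x : Euc d | 0 < x (lastCoord d)}

/-- The hyperplane `{x_d = 0}`. -/
def flatBdry (d : ℕ) [NeZero d] : Set (Euc d) := {x : Euc d | x (lastCoord d) = 0}

/-- The half ball `B_r⁺ = B_r(0) ∩ {x_d > 0}`. -/
def halfBall (d : ℕ) [NeZero d] (r : ℝ) : Set (Euc d) := ball (0:Euc d) r ∩ upperHalf d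

/-- The flat boundary portion `T_r = B_r(0) ∩ {x_d = 0}`. -/
def flatPart (d : ℕ) [NeZero d] (r : ℝ) : Set (Euc d) := ball (0:Euc d) r ∩ flatBdry d

/-- Weak (adjoint) solution of `L*u = div²f + div g + h` in `B₂⁺` with boundary condition
`(Aν·ν)u = fν·ν` on `T₂`, via test functions `v ∈ C_c^∞(B₂)` vanishing on `T₂`. -/
def IsAdjSolBdry {d : ℕ} [NeZero d] (A : Euc d → Fin d → Fin d → ℝ) (b : Euc d → Euc d)
    (c : Euc d → ℝ) (f : Euc d → Fin d → Fin d → ℝ) (g : Euc d → Euc d) (h : Euc d → ℝ)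
    (u : Euc d → ℝ) : Prop :=
  ∀ v : Euc d → ℝ, ContDiff ℝ (⊤ : ℕ∞) v → HasCompactSupport v →
    tsupport v ⊆ ball (0:Euc d) 2 → (∀ x ∈ flatPart d 2, v x = 0) →
    ∫ x in halfBall d 2, u x * ((∑ i, ∑ j, A x i j * pd2 i j v x) +
        (∑ i, b x i * pd i v x) + c x * v x)
      = ∫ x in halfBall d 2, ((∑ i, ∑ j, f x i j * pd2 i j v x) -
          (∑ i, g x i * pd i v x) + h x * v x)


lemma integrable_tsum_aux {F : ℕ → ℝ → ℝ} {μ : Measure ℝ} {b : ℕ → ℝ}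
    (hF : ∀ i, Integrable (F i) μ) (hs : ∀ᵐ t ∂μ, Summable fun i => F i t)
    (hb : Summable b) (hFb : ∀ i, ∫ t, ‖F i t‖ ∂μ ≤ b i) :
    Integrable (fun t => ∑' i, F i t) μ := by
  refine ⟨?_, ?_⟩
  · refine aestronglyMeasurable_of_tendsto_ae (u := atTop)
      (f := fun n t => ∑ i ∈ Finset.range n, F i t) ?_ ?_
    · intro n
      exact Finset.aestronglyMeasurable_fun_sum _ (fun i _ => (hF i).1)
    · filter_upwards [hs] with t ht
      exact ht.hasSum.tendsto_sum_nat
  · have h1 : ∫⁻ t, ‖∑' i, F i t‖ₑ ∂μ ≤ ∫⁻ t, ∑' i, ‖F i t‖ₑ ∂μ := by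
      refine lintegral_mono_ae ?_
      filter_upwards [hs] with t ht
      have hc : Tendsto (fun n => ‖∑ i ∈ Finset.range n, F i t‖ₑ) atTop
          (nhds ‖∑' i, F i t‖ₑ) := (continuous_enorm.tendsto _).comp ht.hasSum.tendsto_sum_nat
      refine le_of_tendsto' hc fun n => ?_
      exact (enorm_sum_le _ _).trans (ENNReal.sum_le_tsum _)
    refine lt_of_le_of_lt h1 ?_
    rw [lintegral_tsum (fun i => (hF i).1.enorm)]
    have h2 : ∀ i, ∫⁻ t, ‖F i t‖ₑ ∂μ ≤ ENNReal.ofReal (b i) := by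
      intro i
      rw [← ofReal_integral_norm_eq_lintegral_enorm (hF i)]
      exact ENNReal.ofReal_le_ofReal (hFb i)
    exact lt_of_le_of_lt (ENNReal.tsum_le_tsum h2) hb.tsum_ofReal_lt_top

lemma dini_piece (ω : ℝ → ℝ) (hωnn : ∀ t : ℝ, 0 < t → t ≤ 1 → 0 ≤ ω t)
    (hI : IntegrableOn (fun t => ω t / t) (Ioc (0:ℝ) 1)) (a c : ℝ) (ha : 0 ≤ a)
    (hc : 0 < c) (hc1 : c ≤ 1) :
    IntegrableOn (fun t => a * (if t / c ≤ 1 then ω (t / c) else ω 1) / t) (Ioc (0:ℝ) 1) ∧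
    ∫ t in Ioc (0:ℝ) 1, ‖a * (if t / c ≤ 1 then ω (t / c) else ω 1) / t‖ ≤
      a * ((∫ t in Ioc (0:ℝ) 1, ω t / t) + ω 1 * Real.log (1 / c)) := by
  set G : ℝ → ℝ := (Ioc (0:ℝ) 1).indicator (fun t => ω t / t) with hG
  have hGi : Integrable G := hI.integrable_indicator measurableSet_Ioc
  have hGc : Integrable (fun t => c⁻¹ * G (t / c)) := (hGi.comp_div hc.ne').const_mul _
  have hGint : ∫ t, c⁻¹ * G (t / c) = ∫ t in Ioc (0:ℝ) 1, ω t / t := by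
    rw [integral_const_mul, Measure.integral_comp_div, abs_of_pos hc, smul_eq_mul,
      inv_mul_cancel_left₀ hc.ne', hG, integral_indicator measurableSet_Ioc]
  have hGnn : ∀ t, 0 ≤ c⁻¹ * G (t / c) := by
    intro t
    refine mul_nonneg (inv_nonneg.2 hc.le) (indicator_nonneg ?_ _)
    intro s hs
    exact div_nonneg (hωnn s hs.1 hs.2) hs.1.le
  have hinv : IntegrableOn (fun t : ℝ => t⁻¹) (Ioc c 1) := by
    rw [← intervalIntegrable_iff_integrableOn_Ioc_of_le hc1]
    refine intervalIntegral.intervalIntegrable_inv (fun x hx => ?_) continuousOn_id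
    rw [uIcc_of_le hc1] at hx
    exact (hc.trans_le hx.1).ne'
  set H : ℝ → ℝ := (Ioc c 1).indicator (fun t => ω 1 * t⁻¹) with hH
  have hHi : Integrable H :=
    IntegrableOn.integrable_indicator (Integrable.const_mul hinv _) measurableSet_Ioc
  have hHint : ∫ t, H t = ω 1 * Real.log (1 / c) := by
    rw [hH, integral_indicator measurableSet_Ioc, integral_const_mul,
      ← intervalIntegral.integral_of_le hc1, integral_inv_of_pos hc one_pos]
  have hHnn : ∀ t, 0 ≤ H t := by
    intro t
    refine indicator_nonneg ?_ _
    intro s hs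
    exact mul_nonneg (hωnn 1 one_pos le_rfl) (inv_nonneg.2 (hc.trans hs.1).le)
  have hK : Integrable (fun t => a * (c⁻¹ * G (t / c) + H t)) := (hGc.add hHi).const_mul a
  have heq : ∀ t ∈ Ioc (0:ℝ) 1, a * (if t / c ≤ 1 then ω (t / c) else ω 1) / t
      = a * (c⁻¹ * G (t / c) + H t) := by
    intro t ht
    have ht0 := ht.1
    by_cases h : t / c ≤ 1
    · have hn : t ∉ Ioc c 1 := fun h' => by
        rw [div_le_one hc] at h; exact absurd h'.1 (not_lt.2 h)
      rw [hG, hH, indicator_of_mem (show t / c ∈ Ioc (0:ℝ) 1 from ⟨div_pos ht0 hc, h⟩), indicator_of_notMem hn, if_pos h]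
      field_simp
      ring
    · have hn : t ∈ Ioc c 1 := by
        rw [div_le_one hc] at h; exact ⟨not_le.1 h, ht.2⟩
      rw [hG, hH, indicator_of_notMem (fun h' => h h'.2), indicator_of_mem hn, if_neg h]
      field_simp
      ring
  refine ⟨(hK.integrableOn).congr_fun (fun t ht => (heq t ht).symm) measurableSet_Ioc, ?_⟩
  have hnn : ∀ t, 0 ≤ a * (c⁻¹ * G (t / c) + H t) := fun t =>
    mul_nonneg ha (add_nonneg (hGnn t) (hHnn t))
  calc _ = ∫ t in Ioc (0:ℝ) 1, a * (c⁻¹ * G (t / c) + H t) := by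
        refine setIntegral_congr_fun measurableSet_Ioc fun t ht => ?_
        beta_reduce
        rw [heq t ht, Real.norm_of_nonneg (hnn t)]
    _ ≤ ∫ t, a * (c⁻¹ * G (t / c) + H t) :=
        setIntegral_le_integral hK (Eventually.of_forall hnn)
    _ = _ := by rw [integral_const_mul, integral_add hGc hHi, hGint, hHint]

/-- Properties of the modified oscillation function `ω̃`
(cf. (2.15) of the paper). -/
theorem stmt13 (κ β : ℝ) (hκ : 0 < κ) (hκ1 : κ < 1) (hβ : 0 < β) (hβ1 : β < 1)
    (ω : ℝ → ℝ) (hωnn : ∀ t : ℝ, 0 < t → t ≤ 1 → 0 ≤ ω t)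
    (hωm : Measurable ω) (hωbdd : ∃ M, ∀ t : ℝ, 0 < t → t ≤ 1 → ω t ≤ M) :
    (IntegrableOn (fun t => ω t / t) (Ioc (0:ℝ) 1) →
      IntegrableOn (fun t =>
        (∑' i : ℕ, κ ^ (((i:ℝ) + 1) * β) *
          (if t / κ ^ (i + 1) ≤ 1 then ω (t / κ ^ (i + 1)) else ω 1)) / t)
        (Ioc (0:ℝ) 1)) ∧
    (∀ C₁ : ℝ, 1 ≤ C₁ →
      (∀ s t : ℝ, 0 < s → s ≤ t → t ≤ 1 → ω s ≤ C₁ * ω t) →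
      ∀ t : ℝ, 0 < t → t ≤ 1 →
        ω t ≤ C₁ * κ ^ (-β) *
          ∑' i : ℕ, κ ^ (((i:ℝ) + 1) * β) *
            (if t / κ ^ (i + 1) ≤ 1 then ω (t / κ ^ (i + 1)) else ω 1)) := by
  obtain ⟨M, hM⟩ := hωbdd
  have hq0 : 0 < κ ^ β := Real.rpow_pos_of_pos hκ β
  have hq1 : κ ^ β < 1 := Real.rpow_lt_one hκ.le hκ1 hβ
  have hqn : ‖κ ^ β‖ < 1 := by rwa [Real.norm_of_nonneg hq0.le]
  have hpow : ∀ i : ℕ, κ ^ (((i:ℝ) + 1) * β) = (κ ^ β) ^ (i + 1) := by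
    intro i
    rw [mul_comm, Real.rpow_mul hκ.le, ← Real.rpow_natCast (κ ^ β) (i + 1)]
    push_cast
    rfl
  have hc0 : ∀ i : ℕ, 0 < κ ^ (i + 1) := fun i => pow_pos hκ _
  have hgs : Summable fun i : ℕ => (κ ^ β) ^ (i + 1) :=
    (summable_nat_add_iff 1).2 (summable_geometric_of_lt_one hq0.le hq1)
  have hval : ∀ t : ℝ, 0 < t → ∀ i : ℕ,
      0 ≤ (if t / κ ^ (i + 1) ≤ 1 then ω (t / κ ^ (i + 1)) else ω 1) ∧
      (if t / κ ^ (i + 1) ≤ 1 then ω (t / κ ^ (i + 1)) else ω 1) ≤ M := by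
    intro t ht i
    split_ifs with h
    · exact ⟨hωnn _ (div_pos ht (hc0 i)) h, hM _ (div_pos ht (hc0 i)) h⟩
    · exact ⟨hωnn 1 one_pos le_rfl, hM 1 one_pos le_rfl⟩
  have hsum : ∀ t : ℝ, 0 < t → Summable fun i : ℕ => κ ^ (((i:ℝ) + 1) * β) *
      (if t / κ ^ (i + 1) ≤ 1 then ω (t / κ ^ (i + 1)) else ω 1) := by
    intro t ht
    refine Summable.of_nonneg_of_le (fun i => ?_) (fun i => ?_) (hgs.mul_right M)
    · exact mul_nonneg (Real.rpow_nonneg hκ.le _) (hval t ht i).1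
    · rw [hpow]
      exact mul_le_mul_of_nonneg_left (hval t ht i).2 (pow_nonneg hq0.le _)
  constructor
  · intro hI
    simp_rw [← tsum_div_const]
    have hp : ∀ i : ℕ, _ := fun i => dini_piece ω hωnn hI (κ ^ (((i:ℝ) + 1) * β)) (κ ^ (i + 1))
      (Real.rpow_nonneg hκ.le _) (hc0 i) (pow_le_one₀ hκ.le hκ1.le)
    refine integrable_tsum_aux (fun i => (hp i).1) ?_ ?_ (fun i => (hp i).2)
    · filter_upwards [ae_restrict_mem measurableSet_Ioc] with t ht
      exact (hsum t ht.1).div_const t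
    · have h1 : Summable fun i : ℕ => ((i + 1 : ℕ) : ℝ) ^ 1 * (κ ^ β) ^ (i + 1) :=
        (summable_nat_add_iff (f := fun n : ℕ => (n : ℝ) ^ 1 * (κ ^ β) ^ n) 1).2
          (summable_pow_mul_geometric_of_norm_lt_one 1 hqn)
      refine ((hgs.mul_right (∫ t in Ioc (0:ℝ) 1, ω t / t)).add
        (h1.mul_right (ω 1 * Real.log (1 / κ)))).congr fun i => ?_
      rw [hpow, one_div, one_div, ← inv_pow, Real.log_pow]
      ring
  · intro C₁ hC hmono t ht ht1
    have h0 := (hsum t ht).le_tsum 0 (fun i _ =>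
      mul_nonneg (Real.rpow_nonneg hκ.le _) (hval t ht i).1)
    have h1 : ω t ≤ C₁ * (if t / κ ^ (0 + 1) ≤ 1 then ω (t / κ ^ (0 + 1)) else ω 1) := by
      split_ifs with h
      · refine hmono _ _ ht ?_ h
        rw [zero_add, pow_one]
        exact le_div_self ht.le hκ hκ1.le
      · exact hmono _ _ ht ht1 le_rfl
    have hinv : κ ^ (-β) * κ ^ β = 1 := by
      rw [Real.rpow_neg hκ.le, inv_mul_cancel₀ hq0.ne']
    refine h1.trans ?_
    have h2 := mul_le_mul_of_nonneg_left h0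
      (mul_nonneg (zero_le_one.trans hC) (Real.rpow_nonneg hκ.le (-β)))
    refine le_trans (le_of_eq ?_) h2
    rw [hpow 0, zero_add, pow_one, pow_one]
    linear_combination (-C₁ * (if t / κ ≤ 1 then ω (t / κ) else ω 1)) * hinv
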